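/- arXiv:0908.0428 — 6 statements merged into one kernel-verified Lean document; each statement's English description precedes it below -/
import Mathlib

section
/- Let L be a join-semilattice with finite connected decompositions, let (A, B) be a finite duality in L, and let M be a transversal of A such that A_Cn ∖ ↑M = ∅. Then A = M = A_Cn, and B has at most one element (so B is a singleton whenever it is nonempty). -/
open Set

/-- `upSet M = {x | ∃ m ∈ M, m ≤ x}`. -/
def upSet {L : Type*} [Preorder L] (M : Set L) : Set L := {x | ∃ m ∈ M, m ≤ x}

/-- `downSet M = {x | ∃ m ∈ M, x ≤ m}`. -/
def downSet {L : Type*} [Preorder L] (M : Set L) : Set L := {x | ∃ m ∈ M, x ≤ m}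

/-- A finite duality `(A, B)`: finite antichains such that
`x ∈ ↑A` iff `x ∉ ↓B`. -/
def FiniteDuality {L : Type*} [Preorder L] (A B : Set L) : Prop :=
  A.Finite ∧ B.Finite ∧ IsAntichain (· ≤ ·) A ∧ IsAntichain (· ≤ ·) B ∧
    ∀ x : L, (∃ a ∈ A, a ≤ x) ↔ ¬ ∃ b ∈ B, x ≤ b

/-- `(l, r)` is a duality pair if `¬ l ≤ x ↔ x ≤ r` for all `x`. -/
def DualityPair {L : Type*} [Preorder L] (l r : L) : Prop :=
  ∀ x : L, ¬ l ≤ x ↔ x ≤ r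

/-- An element is connected (join-prime) if `a ≤ b ⊔ c` implies `a ≤ b` or `a ≤ c`. -/
def ConnectedElt {L : Type*} [SemilatticeSup L] (a : L) : Prop :=
  ∀ b c : L, a ≤ b ⊔ c → a ≤ b ∨ a ≤ c

/-- `L` has finite connected decompositions: every element is the supremum of a
finite nonempty set of connected elements. -/
def HasFiniteConnectedDecompositions (L : Type*) [SemilatticeSup L] : Prop :=
  ∀ a : L, ∃ (F : Finset L) (h : F.Nonempty),
    (∀ c ∈ F, ConnectedElt c) ∧ F.sup' h id = a

/-- `c` is a connected component of `a`: `c` is connected and either `c = a` or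
there is `b` with `a = b ⊔ c ≠ b`. -/
def IsConnComponent {L : Type*} [SemilatticeSup L] (c a : L) : Prop :=
  ConnectedElt c ∧ (c = a ∨ ∃ b : L, a = b ⊔ c ∧ b ⊔ c ≠ b)

/-- `connComponents A` is the set of connected components of elements of `A`. -/
def connComponents {L : Type*} [SemilatticeSup L] (A : Set L) : Set L :=
  {c | ∃ a ∈ A, IsConnComponent c a}

/-- A quasitransversal of `A`: an antichain `M ⊆ A_Cn` with `A ⊆ ↑M`. -/
def IsQuasitransversal {L : Type*} [SemilatticeSup L] (M A : Set L) : Prop :=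
  M ⊆ connComponents A ∧ IsAntichain (· ≤ ·) M ∧ A ⊆ upSet M

/-- A transversal of `A`: a quasitransversal maximal in the refinement order
`M ⊴ N ↔ N ⊆ ↑M`. -/
def IsTransversal {L : Type*} [SemilatticeSup L] (M A : Set L) : Prop :=
  IsQuasitransversal M A ∧
    ∀ N : Set L, IsQuasitransversal N A → N ⊆ upSet M → N = M

/-- The set of weak left duals: elements of `A` for some finite duality `(A, B)`
with `B` nonempty. -/
def wld (L : Type*) [Preorder L] : Set L :=
  {a | ∃ A B : Set L, FiniteDuality A B ∧ B.Nonempty ∧ a ∈ A}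

/-- The sparse incomparability axiom. -/
def SIA (L : Type*) [Preorder L] : Prop :=
  ∀ (x : L) (M U : Set L), M.Finite → U.Finite →
    (insert x (upSet U)) ∩ wld L = ∅ →
    ∃ y : L, y ∉ wld L ∧ y ≤ x ∧ y ∉ upSet (insert x U) ∧
      ∀ m ∈ M, (y ≤ m ↔ x ≤ m)

/-- If finite connected decompositions exist, an element `a ≠ m` has a connected component
different from `m`. -/
lemma exists_isConnComponent_ne {L : Type*} [SemilatticeSup L]
    (hL : HasFiniteConnectedDecompositions L) {a m : L} (ham : a ≠ m) :
    ∃ c, IsConnComponent c a ∧ c ≠ m := by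
  classical
  obtain ⟨F, hF⟩ := exists_minimal_of_wellFoundedLT
    (fun F : Finset L => (∀ c ∈ F, ConnectedElt c) ∧ ∃ h : F.Nonempty, F.sup' h id = a) (by
      obtain ⟨F, h, hc, hs⟩ := hL a
      exact ⟨F, hc, h, hs⟩)
  obtain ⟨hconn, hne, hsup⟩ := hF.prop
  obtain ⟨c, hc, hcm⟩ : ∃ c ∈ F, c ≠ m := by
    by_contra! hall
    obtain rfl : F = {m} := Finset.eq_singleton_iff_nonempty_unique_mem.2 ⟨hne, hall⟩
    exact ham (by simpa using hsup.symm)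
  refine ⟨c, ⟨hconn c hc, ?_⟩, hcm⟩
  rcases (F.erase c).eq_empty_or_nonempty with hE | hE
  · left
    obtain rfl : F = {c} := ((Finset.erase_eq_empty_iff F c).1 hE).resolve_left hne.ne_empty
    simpa using hsup
  · right
    have ha : a = (F.erase c).sup' hE id ⊔ c := by
      rw [← hsup]
      apply le_antisymm
      · refine Finset.sup'_le _ _ fun x hx => ?_
        by_cases hxc : x = c
        · exact (le_of_eq hxc).trans le_sup_right
        · exact (Finset.le_sup' id (Finset.mem_erase.2 ⟨hxc, hx⟩)).trans le_sup_left
      · exact sup_le (Finset.sup'_mono id (Finset.erase_subset c F) hE) (Finset.le_sup' id hc)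
    refine ⟨_, ha, fun h => ?_⟩
    exact Finset.notMem_erase c F (hF.le_of_le
      ⟨fun x hx => hconn x (Finset.mem_of_mem_erase hx), hE, h.symm.trans ha.symm⟩
      (Finset.erase_subset c F) hc)

/-- A connected element is its own only connected component. -/
lemma IsConnComponent.eq_of_connectedElt {L : Type*} [SemilatticeSup L] {a c : L}
    (hc : IsConnComponent c a) (ha : ConnectedElt a) : c = a := by
  rcases hc.2 with h | ⟨b, hab, hb⟩
  · exact h
  · rcases ha b c hab.le with h | h
    · exact absurd (le_antisymm (hab ▸ h) le_sup_left) hb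
    · exact le_antisymm (hab ▸ le_sup_right) h

/-- The minimal elements of a choice of connected components, one for each element of a finite
set `A`, form a quasitransversal of `A`. -/
lemma isQuasitransversal_minimal_image {L : Type*} [SemilatticeSup L] {A : Set L}
    (hA : A.Finite) {s : L → L} (hs : ∀ a ∈ A, IsConnComponent (s a) a) :
    IsQuasitransversal {x | Minimal (· ∈ s '' A) x} A := by
  refine ⟨?_, setOfPred_minimal_antichain _, fun a ha => ?_⟩
  · rintro x ⟨⟨a, ha, rfl⟩, -⟩
    exact ⟨a, ha, hs a ha⟩
  · obtain ⟨b, hb, hmin⟩ := (hA.image s).exists_le_minimal (Set.mem_image_of_mem s ha)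
    refine ⟨b, hmin, hb.trans ?_⟩
    rcases (hs a ha).2 with h | ⟨d, hd, -⟩
    · exact h.le
    · exact le_sup_right.trans hd.ge

/-- If every left dual of a finite duality is connected, there is at most one right dual. -/
lemma FiniteDuality.subsingleton_of_connectedElt {L : Type*} [SemilatticeSup L] {A B : Set L}
    (hAB : FiniteDuality A B) (hA : ∀ a ∈ A, ConnectedElt a) : B.Subsingleton := by
  obtain ⟨-, -, -, hB, hdual⟩ := hAB
  intro b hb c hc
  by_cases h : ∃ a ∈ A, a ≤ b ⊔ c
  · obtain ⟨a, ha, hle⟩ := h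
    rcases hA a ha b c hle with h | h
    · exact absurd ⟨b, hb, le_rfl⟩ ((hdual b).1 ⟨a, ha, h⟩)
    · exact absurd ⟨c, hc, le_rfl⟩ ((hdual c).1 ⟨a, ha, h⟩)
  · rw [hdual, not_not] at h
    obtain ⟨d, hd, hle⟩ := h
    exact (hB.eq hb hd (le_sup_left.trans hle)).trans
      (hB.eq hc hd (le_sup_right.trans hle)).symm

/-- if a transversal `M` of a finite duality `(A, B)` satisfies
`A_Cn \ ↑M = ∅`, then `A = M = A_Cn` and `B` has at most one element. -/
theorem transversal_full_cover {L : Type*} [SemilatticeSup L]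
    (hL : HasFiniteConnectedDecompositions L) (A B M : Set L)
    (hAB : FiniteDuality A B) (hM : IsTransversal M A)
    (hMbar : connComponents A \ upSet M = ∅) :
    A = M ∧ M = connComponents A ∧ B.Subsingleton := by
  obtain ⟨⟨hMC, -, hAM⟩, hmax⟩ := hM
  have hMA : M ⊆ A := by
    intro m hm
    by_contra hmA
    have hex : ∀ a, ∃ c, a ∈ A → IsConnComponent c a ∧ c ≠ m := fun a => by
      by_cases ha : a ∈ A
      · obtain ⟨c, hc⟩ := exists_isConnComponent_ne hL (ne_of_mem_of_not_mem ha hmA)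
        exact ⟨c, fun _ => hc⟩
      · exact ⟨a, fun h => absurd h ha⟩
    choose s hs using hex
    have hN := isQuasitransversal_minimal_image hAB.1 fun a ha => (hs a ha).1
    rw [← hmax _ hN (hN.1.trans (Set.sdiff_eq_empty.1 hMbar))] at hm
    obtain ⟨a, ha, hsa⟩ := hm.prop
    exact (hs a ha).2 hsa
  have hAeq : A = M := by
    refine Set.Subset.antisymm (fun a ha => ?_) hMA
    obtain ⟨m, hm, hle⟩ := hAM ha
    exact hAB.2.2.1.eq (hMA hm) ha hle ▸ hm
  have hconn : ∀ a ∈ A, ConnectedElt a := fun a ha => by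
    obtain ⟨_, -, hc⟩ := hMC (hAeq ▸ ha)
    exact hc.1
  refine ⟨hAeq, Set.Subset.antisymm hMC ?_, hAB.subsingleton_of_connectedElt hconn⟩
  rintro c ⟨a, ha, hc⟩
  rw [hc.eq_of_connectedElt (hconn a ha), ← hAeq]
  exact ha
end

section
/- Let L be a join-semilattice with finite connected decompositions, let (A, B) be a finite duality in L with B nonempty, and let M be a transversal of A. Then there is precisely one element r ∈ B such that M ∩ ↓{r} = ∅ and A_Cn ∖ ↑M ⊆ ↓{r}. -/
open Set

theorem ConnectedElt.exists_le_of_le_sup' {L : Type*} [SemilatticeSup L] {c : L}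
    (hc : ConnectedElt c) {F : Finset L} (hF : F.Nonempty) (h : c ≤ F.sup' hF id) :
    ∃ f ∈ F, c ≤ f := by
  induction hF using Finset.Nonempty.cons_induction with
  | singleton a => exact ⟨a, by simp, by simpa using h⟩
  | cons a s ha hs ih =>
    rw [Finset.sup'_cons hs] at h
    rcases hc _ _ h with h | h
    · exact ⟨a, by simp, h⟩
    · obtain ⟨f, hf, hcf⟩ := ih h
      exact ⟨f, by simp [hf], hcf⟩

theorem IsConnComponent.le {L : Type*} [SemilatticeSup L] {c a : L}
    (h : IsConnComponent c a) : c ≤ a := by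
  rcases h.2 with rfl | ⟨b, rfl, -⟩
  · exact le_rfl
  · exact le_sup_right

/-- Connected components of `a` occur in every connected decomposition of `a`. -/
theorem IsConnComponent.mem_of_sup'_eq {L : Type*} [SemilatticeSup L] {c a : L}
    (h : IsConnComponent c a) {F : Finset L} (hF : F.Nonempty)
    (hconn : ∀ f ∈ F, ConnectedElt f) (ha : F.sup' hF id = a) : c ∈ F := by
  obtain ⟨f, hf, hcf⟩ := h.1.exists_le_of_le_sup' hF (ha ▸ h.le)
  have hfa : f ≤ a := ha ▸ Finset.le_sup' id hf
  rcases h.2 with rfl | ⟨b, rfl, hb⟩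
  · rwa [le_antisymm hcf hfa]
  · rcases hconn f hf _ _ hfa with hfb | hfc
    · exact absurd (sup_eq_left.2 (hcf.trans hfb)) hb
    · rwa [le_antisymm hcf hfc]

theorem HasFiniteConnectedDecompositions.finite_connComponents {L : Type*} [SemilatticeSup L]
    (hL : HasFiniteConnectedDecompositions L) {A : Set L} (hA : A.Finite) :
    (connComponents A).Finite := by
  choose F hF hconn hsup using hL
  refine (hA.biUnion fun a _ => (F a).finite_toSet).subset ?_
  rintro c ⟨a, ha, hca⟩
  exact mem_biUnion ha (hca.mem_of_sup'_eq (hF a) (hconn a) (hsup a))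

/-- An element is bounded by every common upper bound of its connected components. -/
theorem HasFiniteConnectedDecompositions.le_of_forall_isConnComponent {L : Type*}
    [SemilatticeSup L] (hL : HasFiniteConnectedDecompositions L) {a r : L}
    (h : ∀ c, IsConnComponent c a → c ≤ r) : a ≤ r := by
  classical
  obtain ⟨F, hF, hconn, rfl⟩ := hL a
  refine Finset.sup'_le _ _ fun f hf => ?_
  obtain ⟨g, hfg, hg⟩ := F.exists_le_maximal hf
  refine le_trans hfg (h g ⟨hconn g hg.prop, ?_⟩)
  rcases (F.erase g).eq_empty_or_nonempty with he | hne
  · left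
    have hFg : F = {g} := by
      rw [← Finset.insert_erase hg.prop, he]
      rfl
    subst hFg
    simp
  · refine Or.inr ⟨(F.erase g).sup' hne id, ?_, fun heq => ?_⟩
    · have := Finset.sup'_insert (H := hne) (f := id) (b := g)
      rw [sup_comm]
      simpa [Finset.insert_erase hg.prop] using this
    · obtain ⟨k, hk, hgk⟩ := (hconn g hg.prop).exists_le_of_le_sup' hne (sup_eq_left.1 heq)
      rw [Finset.mem_erase] at hk
      exact hk.1 (le_antisymm (hg.le_of_ge hk.2 hgk) hgk)

/-- Each `m` in a transversal is needed: some `a ∈ A` has no connected component in `↑M`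
other than `m`. -/
theorem IsTransversal.exists_forall_isConnComponent {L : Type*} [SemilatticeSup L]
    (hL : HasFiniteConnectedDecompositions L) {A M : Set L} (hA : A.Finite)
    (hM : IsTransversal M A) {m : L} (hm : m ∈ M) :
    ∃ a ∈ A, ∀ c, IsConnComponent c a → c ∈ upSet M → c = m := by
  by_contra! hcon
  have hfin : {c ∈ connComponents A | c ∈ upSet M ∧ c ≠ m}.Finite :=
    (hL.finite_connComponents hA).subset (sep_subset _ _)
  have hN := hM.2 {c | Minimal (· ∈ {c ∈ connComponents A | c ∈ upSet M ∧ c ≠ m}) c}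
    ⟨fun c hc => hc.prop.1, setOfPred_minimal_antichain _, fun a ha => by
      obtain ⟨c, hca, hcM, hcm⟩ := hcon a ha
      obtain ⟨n, hnc, hn⟩ := hfin.exists_le_minimal ⟨⟨a, ha, hca⟩, hcM, hcm⟩
      exact ⟨n, hn, hnc.trans hca.le⟩⟩ fun c hc => hc.prop.2.1
  rw [← hN] at hm
  exact hm.prop.2.2 rfl

/-- The components of `A` outside `↑M` have a common upper bound in `B`. -/
theorem IsQuasitransversal.exists_forall_le {L : Type*} [SemilatticeSup L]
    (hL : HasFiniteConnectedDecompositions L) {A B M : Set L}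
    (hAB : FiniteDuality A B) (hB : B.Nonempty) (hM : IsQuasitransversal M A) :
    ∃ r ∈ B, ∀ c ∈ connComponents A \ upSet M, c ≤ r := by
  obtain ⟨S, hS⟩ := ((hL.finite_connComponents hAB.1).sdiff (t := upSet M)).exists_finset
  rcases S.eq_empty_or_nonempty with rfl | hne
  · obtain ⟨r, hr⟩ := hB
    exact ⟨r, hr, fun c hc => absurd ((hS c).2 hc) (Finset.notMem_empty c)⟩
  · by_contra! hcon
    obtain ⟨a, ha, has⟩ := (hAB.2.2.2.2 (S.sup' hne id)).2 fun ⟨r, hr, hsr⟩ => by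
      obtain ⟨c, hc, hcr⟩ := hcon r hr
      exact hcr ((Finset.le_sup' id ((hS c).2 hc)).trans hsr)
    obtain ⟨m, hm, hma⟩ := hM.2.2 ha
    obtain ⟨_, _, hmconn, -⟩ := hM.1 hm
    obtain ⟨c, hc, hmc⟩ := hmconn.exists_le_of_le_sup' hne (hma.trans has)
    exact ((hS c).1 hc).2 ⟨m, hm, hmc⟩

/-- At most one element of `B` bounds no element of a given quasitransversal. -/
theorem IsQuasitransversal.eq_of_inter_downSet_eq_empty {L : Type*} [SemilatticeSup L]
    {A B M : Set L} (hAB : FiniteDuality A B) (hM : IsQuasitransversal M A) {r s : L}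
    (hr : r ∈ B) (hs : s ∈ B) (hMr : M ∩ downSet {r} = ∅) (hMs : M ∩ downSet {s} = ∅) :
    r = s := by
  by_contra hrs
  obtain ⟨-, -, -, hBanti, hdual⟩ := hAB
  obtain ⟨a, ha, hars⟩ := (hdual (r ⊔ s)).2 fun ⟨b, hb, hrsb⟩ =>
    hrs ((hBanti.eq hr hb (le_sup_left.trans hrsb)).trans
      (hBanti.eq hs hb (le_sup_right.trans hrsb)).symm)
  obtain ⟨m, hm, hma⟩ := hM.2.2 ha
  obtain ⟨_, _, hmconn, -⟩ := hM.1 hm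
  rcases hmconn _ _ (hma.trans hars) with h | h
  · exact hMr.subset ⟨hm, r, rfl, h⟩
  · exact hMs.subset ⟨hm, s, rfl, h⟩

/-- for a transversal `M` of a finite duality `(A, B)` with `B`
nonempty, there is exactly one `r ∈ B` with `M ∩ ↓{r} = ∅` and `A_Cn \ ↑M ⊆ ↓{r}`. -/
theorem transversal_unique_rightDual {L : Type*} [SemilatticeSup L]
    (hL : HasFiniteConnectedDecompositions L) (A B M : Set L)
    (hAB : FiniteDuality A B) (hB : B.Nonempty) (hM : IsTransversal M A) :
    ∃! r : L, r ∈ B ∧ M ∩ downSet {r} = ∅ ∧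
      connComponents A \ upSet M ⊆ downSet {r} := by
  obtain ⟨r, hr, hSr⟩ := hM.1.exists_forall_le hL hAB hB
  have hMr : M ∩ downSet {r} = ∅ := by
    refine eq_empty_of_forall_notMem ?_
    rintro m ⟨hm, _, rfl, hmr⟩
    obtain ⟨a, ha, hcomp⟩ := hM.exists_forall_isConnComponent hL hAB.1 hm
    refine (hAB.2.2.2.2 a).1 ⟨a, ha, le_rfl⟩ ⟨_, hr, hL.le_of_forall_isConnComponent ?_⟩
    intro c hca
    by_cases hcM : c ∈ upSet M
    · exact (hcomp c hca hcM).trans_le hmr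
    · exact hSr c ⟨⟨a, ha, hca⟩, hcM⟩
  exact ⟨r, ⟨hr, hMr, fun c hc => ⟨r, rfl, hSr c hc⟩⟩, fun s hs =>
    hM.1.eq_of_inter_downSet_eq_empty hAB hs.1 hr hs.2.1 hMr⟩
end

section
/- Let L be a Heyting algebra with finite connected decompositions, let (A, B) be a finite duality in L with B nonempty, let a ∈ A, and let c be a connected component of a. Then c is a left dual, i.e., there exists r ∈ L such that (c, r) is a duality pair. -/
open Set

/-- A connected element other than `⊥` lies below a finite supremum only if it lies below one of
the terms. -/
lemma ConnectedElt.not_le_finset_sup {L ι : Type*} [SemilatticeSup L] [OrderBot L] {c : L}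
    (hc : ConnectedElt c) (hbot : ¬ c ≤ ⊥) (s : Finset ι) (f : ι → L)
    (h : ∀ i ∈ s, ¬ c ≤ f i) : ¬ c ≤ s.sup f :=
  Finset.sup_induction (p := fun x => ¬ c ≤ x) hbot
    (fun x hx y hy hxy => (hc x y hxy).elim hx hy) h

/-- If `d ⊔ c` is a member of the left side of a finite duality, with `c` connected and not
below `d`, then `c` is a left dual. -/
lemma FiniteDuality.exists_dualityPair {L : Type*} [HeytingAlgebra L] {A B : Set L}
    (hAB : FiniteDuality A B) {c d : L} (hc : ConnectedElt c) (hcd : ¬ c ≤ d)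
    (ha : d ⊔ c ∈ A) : ∃ r : L, DualityPair c r := by
  classical
  obtain ⟨-, hBfin, hA, -, hdual⟩ := hAB
  have not_le_of_mem : ∀ b ∈ B, d ≤ b → ¬ c ≤ b := fun b hb hdb hcb =>
    (hdual b).1 ⟨_, ha, sup_le hdb hcb⟩ ⟨b, hb, le_rfl⟩
  refine ⟨(hBfin.toFinset.filter (d ≤ ·)).sup (c ⇨ ·), fun x => ⟨fun hx => ?_, fun hx hcx => ?_⟩⟩
  · have hnot : ¬ ∃ a ∈ A, a ≤ d ⊔ x ⊓ c := by
      rintro ⟨a, haA, hle⟩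
      obtain rfl := hA.eq haA ha (hle.trans (sup_le_sup_left inf_le_right d))
      exact (hc _ _ (le_sup_right.trans hle)).elim hcd fun h => hx (h.trans inf_le_left)
    obtain ⟨b, hb, hle⟩ := not_not.1 (mt (hdual _).2 hnot)
    have hmem : b ∈ hBfin.toFinset.filter (d ≤ ·) := by
      simpa using ⟨hb, le_sup_left.trans hle⟩
    exact (le_himp_iff.2 (le_sup_right.trans hle)).trans (Finset.le_sup (f := (c ⇨ ·)) hmem)
  · refine hc.not_le_finset_sup (fun h => hcd (h.trans bot_le)) _ _ (fun b hb h => ?_)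
      (hcx.trans hx)
    simp only [Finset.mem_filter, Set.Finite.mem_toFinset] at hb
    exact not_le_of_mem b hb.1 hb.2 (by simpa using h)

/-- a connected component of a weak left dual is a left dual. -/
theorem connComponent_of_weakLeftDual_is_leftDual {L : Type*} [HeytingAlgebra L]
    (hL : HasFiniteConnectedDecompositions L) (A B : Set L)
    (hAB : FiniteDuality A B) (hB : B.Nonempty) (a : L) (ha : a ∈ A)
    (c : L) (hc : IsConnComponent c a) :
    ∃ r : L, DualityPair c r := by
  obtain ⟨hconn, rfl | ⟨d, rfl, hne⟩⟩ := hc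
  · refine hAB.exists_dualityPair hconn (d := ⊥) (fun h => ?_) (by simpa using ha)
    obtain ⟨b, hb⟩ := hB
    exact (hAB.2.2.2.2 b).1 ⟨c, ha, h.trans bot_le⟩ ⟨b, hb, le_rfl⟩
  · exact hAB.exists_dualityPair hconn (fun h => hne (sup_eq_left.2 h)) ha
end

section
/- Let L be a Heyting algebra with finite connected decompositions and let A be a finite antichain in L such that every a ∈ A is the supremum of a finite nonempty set of left duals. Then there exists a finite subset B ⊆ L such that (A, B) is a finite duality in L. -/
open Set

/-- The elements not above a finite join of left duals are exactly those below one of the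
corresponding right duals. -/
theorem exists_finite_not_sup'_le_iff {L : Type*} [SemilatticeSup L] (F : Finset L)
    (h : F.Nonempty) (hF : ∀ l ∈ F, ∃ r : L, DualityPair l r) :
    ∃ R : Set L, R.Finite ∧ ∀ x : L, ¬ F.sup' h id ≤ x ↔ ∃ r ∈ R, x ≤ r := by
  choose! r hr using hF
  refine ⟨r '' F, F.finite_toSet.image r, fun x => ?_⟩
  simp only [Finset.sup'_le_iff, id, not_forall, exists_mem_image, Finset.mem_coe]
  constructor
  · rintro ⟨l, hl, hx⟩
    exact ⟨l, hl, (hr l hl x).1 hx⟩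
  · rintro ⟨l, hl, hx⟩
    exact ⟨l, hl, (hr l hl x).2 hx⟩

/-- If each principal up-set `↑a` with `a ∈ A` has a finitely generated down-set as its
complement, then so does `↑A` for finite `A`. -/
theorem exists_finite_not_mem_upSet_iff {L : Type*} [SemilatticeInf L] [OrderTop L]
    {A : Set L} (hAfin : A.Finite)
    (hA : ∀ a ∈ A, ∃ R : Set L, R.Finite ∧ ∀ x : L, ¬ a ≤ x ↔ ∃ r ∈ R, x ≤ r) :
    ∃ B : Set L, B.Finite ∧ ∀ x : L, (¬ ∃ a ∈ A, a ≤ x) ↔ ∃ b ∈ B, x ≤ b := by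
  induction A, hAfin using Set.Finite.induction_on with
  | empty => exact ⟨{⊤}, finite_singleton _, by simp⟩
  | @insert a s _ _ ih =>
    obtain ⟨B, hB, hBx⟩ := ih fun b hb => hA b (mem_insert_of_mem a hb)
    obtain ⟨R, hR, hRx⟩ := hA a (mem_insert a s)
    refine ⟨image2 (· ⊓ ·) R B, hR.image2 _ hB, fun x => ?_⟩
    rw [exists_mem_insert, not_or, hRx, hBx, exists_mem_image2]
    constructor
    · rintro ⟨⟨r, hr, hxr⟩, b, hb, hxb⟩
      exact ⟨r, hr, b, hb, le_inf hxr hxb⟩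
    · rintro ⟨r, hr, b, hb, hx⟩
      exact ⟨⟨r, hr, hx.trans inf_le_left⟩, b, hb, hx.trans inf_le_right⟩

/-- The maximal elements of a finite set form an antichain generating the same down-set. -/
theorem exists_antichain_downSet_iff {L : Type*} [PartialOrder L] {B : Set L}
    (hB : B.Finite) :
    ∃ C : Set L, C.Finite ∧ IsAntichain (· ≤ ·) C ∧
      ∀ x : L, (∃ c ∈ C, x ≤ c) ↔ ∃ b ∈ B, x ≤ b := by
  refine ⟨{b | Maximal (· ∈ B) b}, hB.subset fun b hb => hb.prop,
    setOfPred_maximal_antichain _, fun x => ⟨?_, ?_⟩⟩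
  · rintro ⟨c, hc, hx⟩
    exact ⟨c, hc.prop, hx⟩
  · rintro ⟨b, hb, hx⟩
    obtain ⟨c, hbc, hc⟩ := hB.exists_le_maximal hb
    exact ⟨c, hc, hx.trans hbc⟩

/-- a finite antichain of finite joins of left duals admits a
finite duality. -/
theorem joins_of_leftDuals_have_duality {L : Type*} [HeytingAlgebra L]
    (hL : HasFiniteConnectedDecompositions L) (A : Set L) (hAfin : A.Finite)
    (hAanti : IsAntichain (· ≤ ·) A)
    (hA : ∀ a ∈ A, ∃ (F : Finset L) (h : F.Nonempty),
      (∀ x ∈ F, ∃ rx : L, DualityPair x rx) ∧ F.sup' h id = a) :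
    ∃ B : Set L, FiniteDuality A B := by
  have hcompl : ∀ a ∈ A, ∃ R : Set L, R.Finite ∧ ∀ x : L, ¬ a ≤ x ↔ ∃ r ∈ R, x ≤ r := by
    intro a ha
    obtain ⟨F, h, hF, rfl⟩ := hA a ha
    exact exists_finite_not_sup'_le_iff F h hF
  obtain ⟨B, hB, hBx⟩ := exists_finite_not_mem_upSet_iff hAfin hcompl
  obtain ⟨C, hC, hCanti, hCx⟩ := exists_antichain_downSet_iff hB
  refine ⟨C, hAfin, hC, hAanti, hCanti, fun x => ?_⟩
  rw [hCx, ← hBx, not_not]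
end

section
/- Let L be a Heyting algebra with finite connected decompositions and let A be a finite antichain in L consisting of weak left duals. Then there exists exactly one finite subset B ⊆ L such that (A, B) is a finite duality in L. -/
open Set

/-- The elements not above any member of `A` are exactly those below a member of some
finite set. -/
def HasFiniteObstruction {L : Type*} [Preorder L] (A : Set L) : Prop :=
  ∃ B : Set L, B.Finite ∧ ∀ x : L, (∃ a ∈ A, a ≤ x) ↔ ¬ ∃ b ∈ B, x ≤ b

/-- Elements which are not above a weak left dual `a` lie below one of finitely many elements
`c ⇨ b`, with `c` ranging over a connected decomposition of `a`. -/
theorem hasFiniteObstruction_singleton_of_mem_wld {L : Type*} [HeytingAlgebra L]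
    (hL : HasFiniteConnectedDecompositions L) {a : L} (ha : a ∈ wld L) :
    HasFiniteObstruction {a} := by
  classical
  obtain ⟨A, B, ⟨-, hB, hA, -, h⟩, -, haA⟩ := ha
  obtain ⟨F, hF, hconn, hsup⟩ := hL a
  have hle : ∀ c ∈ F, c ≤ a := fun c hc => hsup ▸ F.le_sup' id hc
  refine ⟨image2 (· ⇨ ·) F B ∩ {r | ¬ a ≤ r},
    (F.finite_toSet.image2 _ hB).inter_of_left _, fun x => ?_⟩
  simp only [mem_singleton_iff, exists_eq_left]
  refine ⟨fun hax ⟨r, hr, hxr⟩ => hr.2 (hax.trans hxr), fun hx => ?_⟩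
  by_contra hax
  obtain ⟨c₀, hc₀, hc₀x⟩ : ∃ c ∈ F, ¬ c ≤ x := by
    by_contra! hall
    exact hax (hsup ▸ Finset.sup'_le hF id hall)
  obtain ⟨c, hc₀c, hc⟩ := F.exists_le_maximal hc₀
  have hcx : ¬ c ≤ x := fun hcx => hc₀x (hc₀c.trans hcx)
  have hprime : SupPrime c :=
    ⟨fun hmin => hcx (hmin.eq_bot ▸ bot_le), fun {_ _} => hconn c hc.prop _ _⟩
  set d := (F.erase c).sup id
  have hcd : ¬ c ≤ d := by
    intro hcd
    obtain ⟨s, hs, hcs⟩ := hprime.le_finset_sup.1 hcd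
    rw [Finset.mem_erase] at hs
    exact hs.1 (hc.eq_of_le hs.2 hcs).symm
  have had : a ≤ c ⊔ d := by
    rw [← hsup]
    refine Finset.sup'_le hF id fun s hs => ?_
    by_cases hsc : s = c
    · exact hsc ▸ le_sup_left
    · exact le_sup_of_le_right (Finset.le_sup (f := id) (Finset.mem_erase.2 ⟨hsc, hs⟩))
  have hya : x ⊓ c ⊔ d ≤ a :=
    sup_le (inf_le_right.trans (hle c hc.prop))
      (Finset.sup_le fun s hs => hle s (Finset.mem_of_mem_erase hs))
  have hcy : ¬ c ≤ x ⊓ c ⊔ d := fun hcy =>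
    (hconn c hc.prop _ _ hcy).elim (fun hle => hcx (hle.trans inf_le_left)) hcd
  have hyA : ¬ ∃ a' ∈ A, a' ≤ x ⊓ c ⊔ d := by
    rintro ⟨a', ha', ha'y⟩
    obtain rfl := hA.eq ha' haA (ha'y.trans hya)
    exact hcy ((hle c hc.prop).trans ha'y)
  rw [h, not_not] at hyA
  obtain ⟨b, hb, hyb⟩ := hyA
  refine hx ⟨c ⇨ b, ⟨mem_image2_of_mem hc.prop hb, fun hab => ?_⟩,
    le_himp_iff.2 (le_sup_left.trans hyb)⟩
  have hcb : c ≤ b := by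
    simpa using (hle c hc.prop).trans hab
  exact (h b).1 ⟨a, haA, had.trans (sup_le hcb (le_sup_right.trans hyb))⟩ ⟨b, hb, le_rfl⟩

theorem hasFiniteObstruction_empty {L : Type*} [Preorder L] [OrderTop L] :
    HasFiniteObstruction (∅ : Set L) :=
  ⟨{⊤}, finite_singleton _, fun x => by simp⟩

theorem HasFiniteObstruction.union {L : Type*} [SemilatticeInf L] {A A' : Set L}
    (hA : HasFiniteObstruction A) (hA' : HasFiniteObstruction A') :
    HasFiniteObstruction (A ∪ A') := by
  obtain ⟨B, hB, h⟩ := hA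
  obtain ⟨B', hB', h'⟩ := hA'
  refine ⟨image2 (· ⊓ ·) B B', hB.image2 _ hB', fun x => ?_⟩
  have hunion : (∃ a ∈ A ∪ A', a ≤ x) ↔ (∃ a ∈ A, a ≤ x) ∨ ∃ a ∈ A', a ≤ x := by
    simp only [mem_union, or_and_right, exists_or]
  have hinf : (∃ r ∈ image2 (· ⊓ ·) B B', x ≤ r) ↔ (∃ b ∈ B, x ≤ b) ∧ ∃ b ∈ B', x ≤ b := by
    constructor
    · rintro ⟨_, ⟨b, hb, b', hb', rfl⟩, hx⟩
      exact ⟨⟨b, hb, hx.trans inf_le_left⟩, b', hb', hx.trans inf_le_right⟩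
    · rintro ⟨⟨b, hb, hxb⟩, b', hb', hxb'⟩
      exact ⟨b ⊓ b', mem_image2_of_mem hb hb', le_inf hxb hxb'⟩
  rw [hunion, hinf, h, h', not_and_or]

/-- Keeping only the maximal elements of a finite obstruction set yields a finite duality. -/
theorem HasFiniteObstruction.exists_finiteDuality {L : Type*} [PartialOrder L] {A : Set L}
    (h : HasFiniteObstruction A) (hfin : A.Finite) (hanti : IsAntichain (· ≤ ·) A) :
    ∃ B : Set L, FiniteDuality A B := by
  obtain ⟨B, hB, h⟩ := h
  refine ⟨{b | Maximal (· ∈ B) b}, hfin, hB.subset fun b hb => hb.prop, hanti,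
    setOfPred_maximal_antichain _, fun x => (h x).trans (not_congr ⟨?_, ?_⟩)⟩
  · rintro ⟨b, hb, hxb⟩
    obtain ⟨m, hbm, hm⟩ := hB.exists_le_maximal hb
    exact ⟨m, hm, hxb.trans hbm⟩
  · rintro ⟨b, hb, hxb⟩
    exact ⟨b, hb.prop, hxb⟩

theorem FiniteDuality.subset_right {L : Type*} [PartialOrder L] {A B B' : Set L}
    (h : FiniteDuality A B) (h' : FiniteDuality A B') : B ⊆ B' := by
  obtain ⟨-, -, -, hB, h⟩ := h
  obtain ⟨-, -, -, -, h'⟩ := h'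
  have hiff : ∀ x, (∃ b ∈ B, x ≤ b) ↔ ∃ b ∈ B', x ≤ b := fun x =>
    not_iff_not.1 ((h x).symm.trans (h' x))
  intro b hb
  obtain ⟨b', hb', hbb'⟩ := (hiff b).1 ⟨b, hb, le_rfl⟩
  obtain ⟨b₂, hb₂, hb'b₂⟩ := (hiff b').2 ⟨b', hb', le_rfl⟩
  obtain rfl := hB.eq hb hb₂ (hbb'.trans hb'b₂)
  exact hbb'.antisymm hb'b₂ ▸ hb'

theorem FiniteDuality.right_unique {L : Type*} [PartialOrder L] {A B B' : Set L}
    (h : FiniteDuality A B) (h' : FiniteDuality A B') : B = B' :=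
  (h.subset_right h').antisymm (h'.subset_right h)

/-- a finite antichain of weak left duals admits exactly one
finite duality. -/
theorem unique_duality_for_weakLeftDual_antichain {L : Type*} [HeytingAlgebra L]
    (hL : HasFiniteConnectedDecompositions L) (A : Set L) (hAfin : A.Finite)
    (hAanti : IsAntichain (· ≤ ·) A) (hA : A ⊆ wld L) :
    ∃! B : Set L, FiniteDuality A B := by
  have hobs : HasFiniteObstruction A := by
    induction A, hAfin using Set.Finite.induction_on with
    | empty => exact hasFiniteObstruction_empty
    | @insert a A _ _ ih =>
      rw [insert_subset_iff] at hA
      exact (hasFiniteObstruction_singleton_of_mem_wld hL hA.1).union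
        (ih (hAanti.subset (subset_insert a A)) hA.2)
  obtain ⟨B, hB⟩ := hobs.exists_finiteDuality hAfin hAanti
  exact ⟨B, hB, fun _ hB' => hB'.right_unique hB⟩
end

section
/- Let L be a partially ordered set and let (A, B) be a finite duality in L. Then A ∪ (B ∖ ↓A) is a finite maximal antichain in L. -/
open Set

/-- for a finite duality `(A, B)`, the set `A ∪ (B \ ↓A)` is a
finite maximal antichain. -/
theorem duality_gives_maximal_antichain {L : Type*} [PartialOrder L]
    (A B : Set L) (h : FiniteDuality A B) :
    (A ∪ (B \ downSet A)).Finite ∧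
    IsAntichain (· ≤ ·) (A ∪ (B \ downSet A)) ∧
    ∀ x : L, ∃ c ∈ A ∪ (B \ downSet A), x ≤ c ∨ c ≤ x := by
  obtain ⟨hAfin, hBfin, hA, hB, hdual⟩ := h
  have not_le : ∀ a ∈ A, ∀ b ∈ B, ¬ a ≤ b := fun a ha b hb hab =>
    (hdual b).1 ⟨a, ha, hab⟩ ⟨b, hb, le_rfl⟩
  refine ⟨hAfin.union (hBfin.subset sdiff_subset), ?_, fun x => ?_⟩
  · rintro x (hx | ⟨hx, hxA⟩) y (hy | ⟨hy, -⟩) hxy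
    · exact hA hx hy hxy
    · exact not_le x hx y hy
    · exact fun hle => hxA ⟨y, hy, hle⟩
    · exact hB hx hy hxy
  · by_cases hx : ∃ b ∈ B, x ≤ b
    · obtain ⟨b, hb, hxb⟩ := hx
      by_cases hbA : b ∈ downSet A
      · obtain ⟨a, ha, hba⟩ := hbA
        exact ⟨a, Or.inl ha, Or.inl (hxb.trans hba)⟩
      · exact ⟨b, Or.inr ⟨hb, hbA⟩, Or.inl hxb⟩
    · obtain ⟨a, ha, hax⟩ := (hdual x).2 hx
      exact ⟨a, Or.inl ha, Or.inr hax⟩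
end
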